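/- For every integer n ≥ 1, the double sum W_2(n) = (-1)^n q^{n(3n-1)/2} in ℚ(q). -/

import Mathlib

open Finset

noncomputable def q : RatFunc ℚ := RatFunc.X

noncomputable def qPoch (a : RatFunc ℚ) (n : ℕ) : RatFunc ℚ :=
  ∏ k ∈ Finset.range n, (1 - a * q ^ k)

noncomputable def qPochZ (a : RatFunc ℚ) (n : ℤ) : RatFunc ℚ :=
  if 0 ≤ n then qPoch a n.toNat else 1 / qPoch (a * q ^ n) (-n).toNat

noncomputable def qbinom (n m : ℤ) : RatFunc ℚ :=
  if 0 ≤ m ∧ m ≤ n then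
    qPoch q n.toNat / (qPoch q m.toNat * qPoch q (n - m).toNat)
  else 0

/-- The multiple sum `U_m(n)`, with the cyclic convention `r_{m+1} = r_1`. -/
noncomputable def Umul (m : ℕ) [NeZero m] (n : ℕ) : RatFunc ℚ :=
  ∑ r ∈ Fintype.piFinset (fun _ : Fin m => Finset.range (2 * n + 2)),
    ∏ k : Fin m,
      ((-1 : RatFunc ℚ) ^ r k * q ^ (r k * (r k - 1) / 2) *
        qPochZ (-q) ((n : ℤ) - r k) * qbinom (2 * (n : ℤ) - r k + 1) (r (k + 1)))

/-- The multiple sum `W_m(n)`, with the cyclic convention `r_{m+1} = r_1`. -/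
noncomputable def Wmul (m : ℕ) [NeZero m] (n : ℕ) : RatFunc ℚ :=
  ∑ r ∈ Fintype.piFinset (fun _ : Fin m => Finset.range (2 * n + 1)),
    ∏ k : Fin m,
      ((-1 : RatFunc ℚ) ^ r k * q ^ (r k * (r k - 1) / 2) *
        qPochZ (-q) ((n : ℤ) - r k) * qbinom (2 * (n : ℤ) - r k) (r (k + 1)))

open Polynomial

/-! ### Nonvanishing facts for the indeterminate `q` -/

lemma q_ne_zero : q ≠ 0 := RatFunc.X_ne_zero

lemma one_sub_q_pow_ne_zero (k : ℕ) : 1 - q ^ (k + 1) ≠ 0 := by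
  intro h
  have h1 : algebraMap ℚ[X] (RatFunc ℚ) (X ^ (k + 1)) = algebraMap ℚ[X] (RatFunc ℚ) 1 := by
    rw [map_pow, RatFunc.algebraMap_X, map_one]
    exact (sub_eq_zero.mp h).symm
  have h2 := congrArg natDegree (RatFunc.algebraMap_injective ℚ h1)
  simp at h2

lemma one_add_q_pow_ne_zero (k : ℕ) : 1 + q ^ k ≠ 0 := by
  intro h
  have h1 : algebraMap ℚ[X] (RatFunc ℚ) (1 + X ^ k) = algebraMap ℚ[X] (RatFunc ℚ) 0 := by
    rw [map_add, map_pow, RatFunc.algebraMap_X, map_one, map_zero]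
    exact h
  have h2 := congrArg (eval 1) (RatFunc.algebraMap_injective ℚ h1)
  norm_num at h2

lemma one_add_q_zpow_ne_zero (k : ℤ) : 1 + q ^ k ≠ 0 := by
  obtain ⟨m, rfl | rfl⟩ := k.eq_nat_or_neg
  · simpa using one_add_q_pow_ne_zero m
  · have h : 1 + q ^ (-(m : ℤ)) = q ^ (-(m : ℤ)) * (1 + q ^ m) := by
      rw [mul_add, mul_one, zpow_neg, zpow_natCast,
        inv_mul_cancel₀ (pow_ne_zero _ q_ne_zero), add_comm]
    rw [h]
    exact mul_ne_zero (zpow_ne_zero _ q_ne_zero) (one_add_q_pow_ne_zero m)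

lemma qPoch_q_succ (n : ℕ) : qPoch q (n + 1) = qPoch q n * (1 - q ^ (n + 1)) := by
  rw [qPoch, prod_range_succ, ← qPoch, pow_succ']

lemma qPoch_q_ne_zero (n : ℕ) : qPoch q n ≠ 0 := by
  induction n with
  | zero => simp [qPoch]
  | succ n ih => rw [qPoch_q_succ]; exact mul_ne_zero ih (one_sub_q_pow_ne_zero n)

/-! ### Gaussian binomials with natural arguments -/

noncomputable def gauss (n m : ℕ) : RatFunc ℚ := qbinom n m

lemma gauss_eq_zero {n m : ℕ} (h : n < m) : gauss n m = 0 := by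
  rw [gauss, qbinom, if_neg (by omega)]

lemma gauss_add (a b : ℕ) :
    gauss (a + b) a = qPoch q (a + b) / (qPoch q a * qPoch q b) := by
  rw [gauss, qbinom, if_pos (by omega)]
  congr 3
  simp

@[simp] lemma gauss_zero_right (n : ℕ) : gauss n 0 = 1 := by
  have h := gauss_add 0 n
  rw [zero_add] at h
  rw [h]
  rw [show qPoch q 0 = 1 by simp [qPoch]]
  simp [qPoch_q_ne_zero n]

@[simp] lemma gauss_self (n : ℕ) : gauss n n = 1 := by
  have h := gauss_add n 0
  rw [add_zero] at h
  rw [h]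
  rw [show qPoch q 0 = 1 by simp [qPoch]]
  simp [qPoch_q_ne_zero n]

lemma gauss_succ_succ (n m : ℕ) :
    gauss (n + 1) (m + 1) = gauss n m + q ^ (m + 1) * gauss n (m + 1) := by
  rcases lt_trichotomy n m with h | rfl | h
  · simp [gauss_eq_zero, h, show n < m + 1 by omega]
  · simp [gauss_eq_zero]
  · obtain ⟨b, rfl⟩ := Nat.exists_eq_add_of_lt h
    have e1 := gauss_add (m + 1) (b + 1)
    have e2 := gauss_add m (b + 1)
    have e3 := gauss_add (m + 1) b
    rw [show m + b + 1 + 1 = m + 1 + (b + 1) by ring, e1, show m + b + 1 = m + (b + 1) by ring, e2,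
      show m + (b + 1) = m + 1 + b by ring, e3, show m + 1 + (b + 1) = m + 1 + b + 1 by ring,
      qPoch_q_succ (m + 1 + b), qPoch_q_succ b, qPoch_q_succ m]
    have h1 := qPoch_q_ne_zero m
    have h2 := qPoch_q_ne_zero b
    have h3 := one_sub_q_pow_ne_zero m
    have h4 := one_sub_q_pow_ne_zero b
    field_simp
    ring

lemma gauss_succ_succ' (n m : ℕ) (hm : m ≤ n) :
    gauss (n + 1) (m + 1) = gauss n (m + 1) + q ^ (n - m) * gauss n m := by
  rcases hm.eq_or_lt with rfl | h
  · simp [gauss_eq_zero]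
  · obtain ⟨b, rfl⟩ := Nat.exists_eq_add_of_lt h
    have e1 := gauss_add (m + 1) (b + 1)
    have e2 := gauss_add m (b + 1)
    have e3 := gauss_add (m + 1) b
    rw [show m + b + 1 - m = b + 1 by omega,
      show m + b + 1 + 1 = m + 1 + (b + 1) by ring, e1, show m + b + 1 = m + (b + 1) by ring, e2,
      show m + (b + 1) = m + 1 + b by ring, e3, show m + 1 + (b + 1) = m + 1 + b + 1 by ring,
      qPoch_q_succ (m + 1 + b), qPoch_q_succ b, qPoch_q_succ m]
    have h1 := qPoch_q_ne_zero m
    have h2 := qPoch_q_ne_zero b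
    have h3 := one_sub_q_pow_ne_zero m
    have h4 := one_sub_q_pow_ne_zero b
    field_simp
    ring

lemma gauss_mul_gauss_sub (n k m : ℕ) :
    gauss n k * gauss (n - k) m = gauss n m * gauss (n - m) k := by
  by_cases h : k + m ≤ n
  · obtain ⟨c, rfl⟩ := Nat.exists_eq_add_of_le h
    have e1 := gauss_add k (m + c)
    have e2 := gauss_add m c
    have e3 := gauss_add m (k + c)
    have e4 := gauss_add k c
    rw [show k + m + c - k = m + c by omega, show k + m + c - m = k + c by omega, e2, e4,
      show k + m + c = k + (m + c) by ring, e1, show k + (m + c) = m + (k + c) by ring, e3]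
    have h1 := qPoch_q_ne_zero m
    have h2 := qPoch_q_ne_zero c
    have h3 := qPoch_q_ne_zero k
    have h4 := qPoch_q_ne_zero (m + c)
    have h5 := qPoch_q_ne_zero (k + c)
    field_simp
  · have h1 : gauss n k * gauss (n - k) m = 0 := by
      by_cases hk : k ≤ n
      · rw [gauss_eq_zero (show n - k < m by omega), mul_zero]
      · rw [gauss_eq_zero (show n < k by omega), zero_mul]
    have h2 : gauss n m * gauss (n - m) k = 0 := by
      by_cases hm : m ≤ n
      · rw [gauss_eq_zero (show n - m < k by omega), mul_zero]
      · rw [gauss_eq_zero (show n < m by omega), zero_mul]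
    rw [h1, h2]

section PascalSums

variable {V : Type*} [AddCommGroup V] [Module (RatFunc ℚ) V]

lemma sum_gauss_succ (n : ℕ) (u : ℕ → V) :
    ∑ m ∈ range (n + 2), gauss (n + 1) m • u m =
      ∑ m ∈ range (n + 1), gauss n m • (q ^ m • u m + u (m + 1)) := by
  rw [sum_range_succ']
  simp only [gauss_succ_succ, add_smul, smul_add, sum_add_distrib]
  have h : ∑ m ∈ range (n + 1), gauss n m • q ^ m • u m =
      ∑ m ∈ range (n + 1), (q ^ (m + 1) * gauss n (m + 1)) • u (m + 1) + u 0 := by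
    have h1 := sum_range_succ (fun m => gauss n m • q ^ m • u m) (n + 1)
    rw [gauss_eq_zero (Nat.lt_succ_self n), zero_smul, add_zero, sum_range_succ'] at h1
    rw [← h1]
    simp [smul_smul, mul_comm]
  rw [h, gauss_zero_right, one_smul]
  abel

lemma sum_gauss_succ' (n : ℕ) (u : ℕ → V) :
    ∑ m ∈ range (n + 2), gauss (n + 1) m • u m =
      ∑ m ∈ range (n + 1), gauss n m • (u m + q ^ (n - m) • u (m + 1)) := by
  rw [sum_range_succ']
  have h0 : ∑ m ∈ range (n + 1), gauss (n + 1) (m + 1) • u (m + 1) =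
      ∑ m ∈ range (n + 1), (gauss n (m + 1) • u (m + 1) + gauss n m • q ^ (n - m) • u (m + 1)) := by
    refine sum_congr rfl fun m hm => ?_
    rw [gauss_succ_succ' n m (by simp at hm; omega), add_smul, smul_smul, mul_comm (gauss n m)]
  simp only [h0, smul_add, sum_add_distrib]
  have h : ∑ m ∈ range (n + 1), gauss n m • u m =
      ∑ m ∈ range (n + 1), gauss n (m + 1) • u (m + 1) + u 0 := by
    have h1 := sum_range_succ (fun m => gauss n m • u m) (n + 1)
    rw [gauss_eq_zero (Nat.lt_succ_self n), zero_smul, add_zero, sum_range_succ'] at h1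
    rw [← h1]
    simp
  rw [h, gauss_zero_right, one_smul]
  abel

end PascalSums

/-! ### Signed triangular powers and the polynomials `(X; q)_n` -/

/-- The factor `(-1)^m q^(m(m-1)/2)`. -/
noncomputable def signTri (m : ℕ) : RatFunc ℚ := (-1) ^ m * q ^ (m * (m - 1) / 2)

@[simp] lemma signTri_zero : signTri 0 = 1 := by simp [signTri]

lemma signTri_succ (m : ℕ) : signTri (m + 1) = -(signTri m * q ^ m) := by
  have h : (m + 1) * (m + 1 - 1) / 2 = m * (m - 1) / 2 + m := by
    rw [← Nat.choose_two_right, ← Nat.choose_two_right, Nat.choose_succ_succ' m 1]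
    simp [add_comm]
  rw [signTri, h, signTri, pow_succ, pow_add]
  ring

lemma signTri_ne_zero (m : ℕ) : signTri m ≠ 0 :=
  mul_ne_zero (pow_ne_zero _ (by norm_num)) (pow_ne_zero _ q_ne_zero)

/-- The polynomial `(X; q)_n`. -/
noncomputable def pochPoly (n : ℕ) : (RatFunc ℚ)[X] := ∏ k ∈ range n, (1 - C (q ^ k) * X)

lemma pochPoly_succ (n : ℕ) : pochPoly (n + 1) = pochPoly n - q ^ n • (X * pochPoly n) := by
  rw [pochPoly, prod_range_succ, ← pochPoly, smul_eq_C_mul]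
  ring

lemma pochPoly_coeff (n s : ℕ) : (pochPoly n).coeff s = signTri s * gauss n s := by
  induction n generalizing s with
  | zero =>
    cases s with
    | zero => simp [pochPoly]
    | succ s => simp [pochPoly, gauss_eq_zero, coeff_one]
  | succ n ih =>
    rw [pochPoly_succ, coeff_sub, coeff_smul, ih]
    cases s with
    | zero => simp
    | succ s =>
      rw [coeff_X_mul, ih, signTri_succ, smul_eq_mul]
      by_cases hs : s ≤ n
      · rw [gauss_succ_succ' n s hs]
        have : q ^ n = q ^ s * q ^ (n - s) := by rw [← pow_add, Nat.add_sub_cancel' hs]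
        rw [this]
        ring
      · simp [gauss_eq_zero, show n < s by omega, show n < s + 1 by omega]

/-- The basis polynomial `X^i (X; q)_(N)`. -/
noncomputable def basisPoly (i N : ℕ) : (RatFunc ℚ)[X] := X ^ i * pochPoly N

lemma sum_gauss_signTri_pochPoly (N i : ℕ) :
    ∑ m ∈ range (N + 1), gauss N m • signTri m • pochPoly (N + i - m) =
      (signTri N * q ^ (i * N)) • basisPoly N i := by
  induction N with
  | zero => simp [basisPoly]
  | succ N ih =>
    rw [sum_gauss_succ]
    have h : ∀ m ∈ range (N + 1),
        gauss N m • (q ^ m • signTri m • pochPoly (N + 1 + i - m) +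
          signTri (m + 1) • pochPoly (N + 1 + i - (m + 1))) =
        (-q ^ (N + i)) • (X * gauss N m • signTri m • pochPoly (N + i - m)) := by
      intro m hm
      have hm : m ≤ N := by simp at hm; omega
      rw [show N + 1 + i - m = N + i - m + 1 by omega, show N + 1 + i - (m + 1) = N + i - m by omega,
        pochPoly_succ, signTri_succ]
      have : q ^ (N + i) = q ^ m * q ^ (N + i - m) := by rw [← pow_add]; congr 1; omega
      rw [this]
      simp only [smul_eq_C_mul, map_neg, map_mul]
      ring
    rw [sum_congr rfl h, ← smul_sum, ← mul_sum, ih, signTri_succ, basisPoly, basisPoly]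
    simp only [smul_eq_C_mul, map_neg, map_mul, map_pow]
    ring

lemma sum_gauss_signTri_inv_pochPoly (N i : ℕ) :
    ∃ b : RatFunc ℚ, ∑ m ∈ range (N + 2), gauss (N + 1) m •
        (signTri m * (q ^ m)⁻¹) • pochPoly (N + 1 + i - m) =
      (signTri (N + 1) * q ^ (i * (N + 1)) * (q ^ (N + 1))⁻¹) • basisPoly (N + 1) i +
        b • basisPoly N (i + 1) := by
  refine ⟨signTri N * q ^ ((i + 1) * N) - q⁻¹ * (signTri N * q ^ (i * N)), ?_⟩
  have hq := q_ne_zero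
  rw [sum_gauss_succ]
  have h : ∀ m ∈ range (N + 1),
      gauss N m • (q ^ m • (signTri m * (q ^ m)⁻¹) • pochPoly (N + 1 + i - m) +
        (signTri (m + 1) * (q ^ (m + 1))⁻¹) • pochPoly (N + 1 + i - (m + 1))) =
      gauss N m • signTri m • pochPoly (N + (i + 1) - m) -
        q⁻¹ • gauss N m • signTri m • pochPoly (N + i - m) := by
    intro m _
    rw [show N + 1 + i - m = N + (i + 1) - m by omega,
      show N + 1 + i - (m + 1) = N + i - m by omega, signTri_succ, smul_smul (q ^ m),
      show q ^ m * (signTri m * (q ^ m)⁻¹) = signTri m by field_simp,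
      show -(signTri m * q ^ m) * (q ^ (m + 1))⁻¹ = -(q⁻¹ * signTri m) by field_simp; ring]
    simp only [smul_eq_C_mul, map_neg, map_mul]
    ring
  rw [sum_congr rfl h, sum_sub_distrib, ← smul_sum, sum_gauss_signTri_pochPoly,
    sum_gauss_signTri_pochPoly, signTri_succ]
  have h2 : basisPoly N i = basisPoly N (i + 1) + q ^ i • basisPoly (N + 1) i := by
    rw [basisPoly, basisPoly, basisPoly, pochPoly_succ]
    simp only [smul_eq_C_mul]
    ring
  rw [h2, smul_add, smul_add, smul_smul, smul_smul, smul_smul, sub_smul]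
  rw [show -(signTri N * q ^ N) * q ^ (i * (N + 1)) * (q ^ (N + 1))⁻¹ =
    -(q⁻¹ * (signTri N * q ^ (i * N)) * q ^ i) by field_simp; ring]
  rw [neg_smul]
  abel

/-! ### The factor `(-q; q)_k` for integral `k` -/

lemma qPoch_neg_q_zpow_ne_zero (a : ℤ) (k : ℕ) : qPoch (-q ^ a) k ≠ 0 := by
  rw [qPoch, prod_ne_zero_iff]
  intro j _
  rw [neg_mul, sub_neg_eq_add, ← zpow_natCast q j, ← zpow_add₀ q_ne_zero]
  exact one_add_q_zpow_ne_zero _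

lemma qPochZ_neg_q_succ (k : ℤ) :
    qPochZ (-q) (k + 1) = (1 + q ^ (k + 1)) * qPochZ (-q) k := by
  have hq := q_ne_zero
  obtain ⟨m, rfl⟩ | ⟨m, rfl⟩ : (∃ m : ℕ, k = m) ∨ ∃ m : ℕ, k = -((m : ℤ) + 1) := by
    rcases le_or_gt 0 k with h | h
    · exact Or.inl ⟨k.toNat, by omega⟩
    · exact Or.inr ⟨(-k - 1).toNat, by omega⟩
  · rw [qPochZ, qPochZ, if_pos (by omega), if_pos (by omega),
      show ((m : ℤ) + 1).toNat = m + 1 by omega, Int.toNat_natCast, qPoch, prod_range_succ, ← qPoch,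
      show ((m : ℤ) + 1) = ((m + 1 : ℕ) : ℤ) by push_cast; rfl, zpow_natCast]
    ring
  · have hneg : qPochZ (-q) (-((m : ℤ) + 1)) = 1 / qPoch (-q ^ (-(m : ℤ))) (m + 1) := by
      rw [qPochZ, if_neg (by omega), show (- -((m : ℤ) + 1)).toNat = m + 1 by omega,
        neg_mul, ← zpow_one_add₀ hq, show 1 + -((m : ℤ) + 1) = -m by ring]
    have hsucc : qPochZ (-q) (-((m : ℤ) + 1) + 1) = 1 / qPoch (-q ^ (1 - (m : ℤ))) m := by
      rw [show -((m : ℤ) + 1) + 1 = -m by ring]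
      cases m with
      | zero => simp [qPochZ, qPoch]
      | succ m =>
        rw [qPochZ, if_neg (by omega), show (- -((m + 1 : ℕ) : ℤ)).toNat = m + 1 by omega,
          neg_mul, ← zpow_one_add₀ hq]
        rfl
    have hprod : qPoch (-q ^ (-(m : ℤ))) (m + 1) =
        (1 + q ^ (-(m : ℤ))) * qPoch (-q ^ (1 - (m : ℤ))) m := by
      rw [qPoch, prod_range_succ', mul_comm, qPoch]
      congr 1
      · ring
      · refine prod_congr rfl fun j _ => ?_
        rw [sub_eq_add_neg (1 : ℤ), zpow_add₀ hq, zpow_one]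
        ring
    have h1 := qPoch_neg_q_zpow_ne_zero (1 - (m : ℤ)) m
    have h2 := one_add_q_zpow_ne_zero (-(m : ℤ))
    rw [hneg, hsucc, hprod, show -((m : ℤ) + 1) + 1 = -m by ring]
    field_simp

lemma qPochZ_neg_q_zero : qPochZ (-q) 0 = 1 := by simp [qPochZ, qPoch]

lemma sum_gauss_signTri_qPochZ (L : ℕ) (a : ℤ) :
    (-1) ^ L * signTri L * ∑ k ∈ range (L + 1), gauss L k • (signTri k * qPochZ (-q) (a - k)) =
      (q ^ a) ^ L * qPochZ (-q) (a - L) := by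
  have hq := q_ne_zero
  induction L generalizing a with
  | zero => simp
  | succ L ih =>
    have h : ∀ k ∈ range (L + 1), gauss L k • (signTri k * qPochZ (-q) (a - k) +
          q ^ (L - k) • (signTri (k + 1) * qPochZ (-q) (a - (k + 1 : ℕ)))) =
        gauss L k • (signTri k * qPochZ (-q) (a - k)) -
          q ^ L * gauss L k • (signTri k * qPochZ (-q) (a - 1 - k)) := by
      intro k hk
      have hk : k ≤ L := by simp at hk; omega
      rw [signTri_succ, show a - ((k + 1 : ℕ) : ℤ) = a - 1 - k by push_cast; ring,
        show q ^ L = q ^ k * q ^ (L - k) by rw [← pow_add, Nat.add_sub_cancel' hk]]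
      simp only [smul_eq_mul]
      ring
    rw [sum_gauss_succ', sum_congr rfl h, sum_sub_distrib, ← mul_sum, signTri_succ]
    have h1 := ih a
    have h2 := ih (a - 1)
    have h3 := qPochZ_neg_q_succ (a - 1 - L)
    rw [show a - 1 - (L : ℤ) + 1 = a - L by ring] at h3
    rw [h3, zpow_sub₀ hq, zpow_natCast] at h1
    rw [zpow_sub_one₀ hq, mul_pow, inv_pow] at h2
    rw [show a - ((L + 1 : ℕ) : ℤ) = a - 1 - L by push_cast; ring]
    generalize qPochZ (-q) (a - 1 - L) = G at *
    generalize q ^ a = y at *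
    have hL : q ^ L ≠ 0 := pow_ne_zero _ hq
    rw [pow_succ (-1 : RatFunc ℚ)]
    field_simp at h1 h2
    linear_combination h1 - q ^ L * h2

lemma zpow_mul_qPochZ_mul_qPochZ (c : ℤ) (L : ℕ) :
    (q ^ c) ^ L * (qPochZ (-q) (c - L) * qPochZ (-q) (L - c)) * (1 + q ^ c) =
      (-1) ^ L * signTri L * (qPochZ (-q) c * qPochZ (-q) (-c)) * (q ^ L + q ^ c) := by
  have hq := q_ne_zero
  induction L with
  | zero => simp
  | succ L ih =>
    have h1 := qPochZ_neg_q_succ (c - (L + 1 : ℕ))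
    have h2 := qPochZ_neg_q_succ (L - c)
    have h3 := one_add_q_zpow_ne_zero (c - L)
    rw [show c - ((L + 1 : ℕ) : ℤ) + 1 = c - L by push_cast; ring] at h1
    rw [show (L : ℤ) - c + 1 = ((L + 1 : ℕ) : ℤ) - c by push_cast; ring] at h2
    rw [h1] at ih
    rw [h2, signTri_succ, pow_succ (-1 : RatFunc ℚ)]
    rw [zpow_sub₀ hq, zpow_natCast] at ih h3 ⊢
    have hL : q ^ L ≠ 0 := pow_ne_zero _ hq
    have hc : q ^ c ≠ 0 := zpow_ne_zero _ hq
    generalize q ^ c = y at *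
    have h4 : q ^ L + y ≠ 0 := by
      intro h
      apply h3
      rw [one_add_div hL, h, zero_div]
    rw [pow_succ q]
    field_simp at ih ⊢
    linear_combination y * (y + q ^ L * q) * ih

/-! ### The matrices -/

/-- The matrix of the operator `X^r ↦ (-q; q)_(n-r) (X; q)_(2n-r)`. -/
noncomputable def opMatrix (n : ℕ) : Matrix (Fin (2 * n + 1)) (Fin (2 * n + 1)) (RatFunc ℚ) :=
  fun r s => qPochZ (-q) ((n : ℤ) - (r : ℕ)) * (pochPoly (2 * n - r)).coeff s

/-- The matrix of coefficients of the polynomials `X^i (X; q)_(2n-i)`. -/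
noncomputable def basisMatrix (n : ℕ) : Matrix (Fin (2 * n + 1)) (Fin (2 * n + 1)) (RatFunc ℚ) :=
  fun i s => (basisPoly i (2 * n - i)).coeff s

lemma basisMatrix_det (n : ℕ) : (basisMatrix n).det = 1 := by
  rw [Matrix.det_of_isUpperTriangular]
  · refine prod_eq_one fun i _ => ?_
    simp [basisMatrix, basisPoly, coeff_X_pow_mul', pochPoly_coeff]
  · intro i j hij
    have hij : (j : ℕ) < i := hij
    rw [basisMatrix, basisPoly, coeff_X_pow_mul', if_neg (by omega)]

lemma basisMatrix_mul_opMatrix (n : ℕ) (i m : Fin (2 * n + 1)) :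
    (basisMatrix n * opMatrix n) i m = gauss (2 * n - i) m * signTri m *
      ∑ k ∈ range (2 * n - i - m + 1),
        gauss (2 * n - i - m) k • (signTri k * qPochZ (-q) ((n : ℤ) - (i : ℕ) - k)) := by
  obtain ⟨i, hi⟩ := i
  obtain ⟨m, hm⟩ := m
  rw [Matrix.mul_apply]
  simp only [basisMatrix, opMatrix, basisPoly, coeff_X_pow_mul', pochPoly_coeff]
  obtain ⟨N, hN⟩ := Nat.exists_eq_add_of_le (show i ≤ 2 * n by omega)
  rw [Fin.sum_univ_eq_sum_range (fun r => (if i ≤ r then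
      signTri (r - i) * gauss (2 * n - i) (r - i) else 0) *
    (qPochZ (-q) ((n : ℤ) - r) * (signTri m * gauss (2 * n - r) m))),
    show 2 * n - i = N by omega, show 2 * n + 1 = i + (N + 1) by omega, sum_range_add,
    sum_eq_zero fun r hr => by rw [if_neg (by simp at hr; omega), zero_mul], zero_add]
  have h : ∀ k ∈ range (N + 1), (if i ≤ i + k then signTri (i + k - i) * gauss N (i + k - i) else 0) *
      (qPochZ (-q) ((n : ℤ) - (i + k : ℕ)) * (signTri m * gauss (2 * n - (i + k)) m)) =
      gauss N m * signTri m *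
        gauss (N - m) k • (signTri k * qPochZ (-q) ((n : ℤ) - i - k)) := by
    intro k _
    rw [if_pos (by omega), Nat.add_sub_cancel_left, show 2 * n - (i + k) = N - k by omega,
      show (n : ℤ) - (i + k : ℕ) = n - i - k by push_cast; ring, smul_eq_mul]
    linear_combination signTri k * signTri m * qPochZ (-q) (n - i - k) * gauss_mul_gauss_sub N k m
  rw [sum_congr rfl h, ← mul_sum]
  congr 1
  symm
  refine sum_subset (range_subset_range.mpr (by omega)) fun k _ hk => ?_
  rw [gauss_eq_zero (by simp at hk; omega), zero_smul]

lemma basisMatrix_mul_opMatrix_mul (n : ℕ) (i m : Fin (2 * n + 1)) :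
    (basisMatrix n * opMatrix n) i m * qPochZ (-q) ((n : ℤ) - (m : ℕ)) =
      qPochZ (-q) ((n : ℤ) - (i : ℕ)) * qPochZ (-q) ((i : ℕ) - (n : ℤ)) /
        (1 + q ^ ((n : ℤ) - (i : ℕ))) * (gauss (2 * n - i) m *
          (signTri m * (q ^ (2 * n - i) * (q ^ (m : ℕ))⁻¹ + q ^ ((n : ℤ) - (i : ℕ))))) := by
  rw [basisMatrix_mul_opMatrix]
  obtain ⟨i, hi⟩ := i
  obtain ⟨m, hm⟩ := m
  simp only
  by_cases hmN : m ≤ 2 * n - i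
  · obtain ⟨L, hL⟩ := Nat.exists_eq_add_of_le hmN
    have h1 := sum_gauss_signTri_qPochZ L ((n : ℤ) - i)
    have h2 := zpow_mul_qPochZ_mul_qPochZ ((n : ℤ) - i) L
    rw [show (n : ℤ) - i - L = m - n by omega] at h1 h2
    rw [show (L : ℤ) - (n - i) = n - m by omega, neg_sub] at h2
    rw [hL, Nat.add_sub_cancel_left]
    have h3 := one_add_q_zpow_ne_zero ((n : ℤ) - i)
    have h4 : (-1 : RatFunc ℚ) ^ L * signTri L ≠ 0 :=
      mul_ne_zero (pow_ne_zero _ (by norm_num)) (signTri_ne_zero L)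
    have h5 : q ^ m ≠ 0 := pow_ne_zero _ q_ne_zero
    rw [pow_add, show q ^ m * q ^ L * (q ^ m)⁻¹ = q ^ L by field_simp]
    generalize ∑ k ∈ range (L + 1), gauss L k • (signTri k * qPochZ (-q) ((n : ℤ) - i - k)) = S at *
    generalize gauss (m + L) m = g at *
    generalize (-1 : RatFunc ℚ) ^ L * signTri L = D at *
    generalize q ^ ((n : ℤ) - i) = y at *
    field_simp
    apply mul_left_cancel₀ h4
    linear_combination g * signTri m * qPochZ (-q) (n - m) * (1 + y) * h1 + g * signTri m * h2
  · rw [gauss_eq_zero (by omega)]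
    simp

/-- Up to a multiple of `X^(N-1) (X; q)_(i+1)`, the square of the operator sends
`X^i (X; q)_N` to a multiple of `X^N (X; q)_i`, where `i + N = 2n`. -/
lemma basisMatrix_mul_opMatrix_sq (n : ℕ) (i : Fin (2 * n + 1)) :
    ∃ b : RatFunc ℚ, ((i : ℕ) = 2 * n → b = 0) ∧ ∀ s : Fin (2 * n + 1),
      (basisMatrix n * opMatrix n * opMatrix n) i s =
        qPochZ (-q) ((n : ℤ) - (i : ℕ)) * qPochZ (-q) ((i : ℕ) - (n : ℤ)) *
          (signTri (2 * n - i) * q ^ ((i : ℕ) * (2 * n - i))) * (basisPoly (2 * n - i) i).coeff s +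
        b * (basisPoly (2 * n - i - 1) (i + 1)).coeff s := by
  have hsum : ∀ s : Fin (2 * n + 1), (basisMatrix n * opMatrix n * opMatrix n) i s =
      qPochZ (-q) ((n : ℤ) - (i : ℕ)) * qPochZ (-q) ((i : ℕ) - (n : ℤ)) /
        (1 + q ^ ((n : ℤ) - (i : ℕ))) *
      (q ^ (2 * n - i) • (∑ m ∈ range (2 * n - i + 1), gauss (2 * n - i) m •
        (signTri m * (q ^ m)⁻¹) • pochPoly (2 * n - i + i - m)) +
      q ^ ((n : ℤ) - (i : ℕ)) • ∑ m ∈ range (2 * n - i + 1), gauss (2 * n - i) m •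
        signTri m • pochPoly (2 * n - i + i - m)).coeff s := by
    intro s
    have hterm : ∀ m : Fin (2 * n + 1),
        (basisMatrix n * opMatrix n) i m * opMatrix n m s =
          (basisMatrix n * opMatrix n) i m * qPochZ (-q) ((n : ℤ) - (m : ℕ)) *
            (pochPoly (2 * n - m)).coeff s := fun m => by rw [mul_assoc]; rfl
    rw [Matrix.mul_apply]
    simp only [hterm, basisMatrix_mul_opMatrix_mul]
    rw [smul_sum, smul_sum, ← sum_add_distrib, finsetSum_coeff, mul_sum]
    rw [Fin.sum_univ_eq_sum_range (fun m => qPochZ (-q) ((n : ℤ) - (i : ℕ)) *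
      qPochZ (-q) ((i : ℕ) - (n : ℤ)) /
        (1 + q ^ ((n : ℤ) - (i : ℕ))) * (gauss (2 * n - i) m *
          (signTri m * (q ^ (2 * n - i) * (q ^ m)⁻¹ + q ^ ((n : ℤ) - (i : ℕ))))) *
        (pochPoly (2 * n - m)).coeff s)]
    symm
    refine sum_subset_zero_on_sdiff (range_subset_range.mpr (by omega)) (fun m hm => ?_)
      fun m _ => ?_
    · rw [gauss_eq_zero (by simp at hm; omega)]
      simp
    · rw [show 2 * n - i + i - m = 2 * n - m by omega]
      simp only [coeff_add, coeff_smul, smul_eq_mul]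
      ring
  have h0 := sum_gauss_signTri_pochPoly (2 * n - i) i
  have hc := one_add_q_zpow_ne_zero ((n : ℤ) - (i : ℕ))
  by_cases hi : (i : ℕ) = 2 * n
  · refine ⟨0, fun _ => rfl, fun s => ?_⟩
    rw [hsum]
    generalize qPochZ (-q) ((n : ℤ) - (i : ℕ)) = g1
    generalize qPochZ (-q) ((i : ℕ) - (n : ℤ)) = g2
    generalize q ^ ((n : ℤ) - (i : ℕ)) = y at *
    rw [hi]
    simp [basisPoly]
    field_simp
  · obtain ⟨N, hN⟩ : ∃ N, 2 * n - (i : ℕ) = N + 1 := ⟨2 * n - i - 1, by omega⟩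
    obtain ⟨b, hb⟩ := sum_gauss_signTri_inv_pochPoly N i
    rw [hN] at h0 hsum ⊢
    rw [hb, h0] at hsum
    refine ⟨qPochZ (-q) ((n : ℤ) - (i : ℕ)) * qPochZ (-q) ((i : ℕ) - (n : ℤ)) /
        (1 + q ^ ((n : ℤ) - (i : ℕ))) * q ^ (N + 1) * b, fun h => absurd h hi, fun s => ?_⟩
    rw [hsum]
    have h5 : q ^ (N + 1) ≠ 0 := pow_ne_zero _ q_ne_zero
    simp only [coeff_add, coeff_smul, smul_eq_mul, Nat.add_sub_cancel]
    generalize qPochZ (-q) ((n : ℤ) - (i : ℕ)) = g1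
    generalize qPochZ (-q) ((i : ℕ) - (n : ℤ)) = g2
    generalize q ^ ((n : ℤ) - (i : ℕ)) = y at *
    generalize q ^ (N + 1) = z at *
    field_simp
    ring

lemma trace_opMatrix_sq (n : ℕ) :
    (opMatrix n * opMatrix n).trace = signTri n * q ^ (n * n) := by
  choose b hb0 hb using basisMatrix_mul_opMatrix_sq n
  let M : Matrix (Fin (2 * n + 1)) (Fin (2 * n + 1)) (RatFunc ℚ) := fun i j =>
    (if j = i.rev then qPochZ (-q) ((n : ℤ) - (i : ℕ)) * qPochZ (-q) ((i : ℕ) - (n : ℤ)) *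
          (signTri (2 * n - i) * q ^ ((i : ℕ) * (2 * n - i))) else 0) +
      if (i : ℕ) + j + 1 = 2 * n then b i else 0
  have hM : basisMatrix n * (opMatrix n * opMatrix n) = M * basisMatrix n := by
    ext i s
    rw [← Matrix.mul_assoc, hb, Matrix.mul_apply]
    simp only [M, add_mul, sum_add_distrib, ite_mul, zero_mul, sum_ite_eq', mem_univ, if_true]
    congr 1
    · simp only [basisMatrix, Fin.val_rev]
      rw [show 2 * n + 1 - ((i : ℕ) + 1) = 2 * n - i by omega,
        show 2 * n - (2 * n - (i : ℕ)) = i by omega]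
    · by_cases hi : (i : ℕ) = 2 * n
      · simp [hb0 i hi]
      · rw [sum_eq_single (⟨2 * n - i - 1, by omega⟩ : Fin (2 * n + 1))]
        · rw [if_pos (by simp only; omega)]
          simp only [basisMatrix]
          rw [show 2 * n - (2 * n - (i : ℕ) - 1) = i + 1 by omega]
        · intro j _ hj
          rw [if_neg]
          intro h
          apply hj
          ext
          simp only
          omega
        · simp
  have hdet : IsUnit (basisMatrix n).det := by rw [basisMatrix_det]; exact isUnit_one
  have htr : (opMatrix n * opMatrix n).trace = M.trace := by
    rw [← Matrix.nonsing_inv_mul_cancel_left (basisMatrix n) (opMatrix n * opMatrix n) hdet, hM,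
      Matrix.trace_mul_comm, Matrix.mul_assoc, Matrix.mul_nonsing_inv _ hdet, Matrix.mul_one]
  rw [htr, Matrix.trace]
  rw [sum_eq_single (⟨n, by omega⟩ : Fin (2 * n + 1))]
  · have h1 : (⟨n, by omega⟩ : Fin (2 * n + 1)) = Fin.rev ⟨n, by omega⟩ := by
      ext
      simp only [Fin.val_rev]
      omega
    simp only [Matrix.diag, M]
    rw [if_pos h1, if_neg (by omega), sub_self, qPochZ_neg_q_zero, show 2 * n - n = n by omega]
    ring
  · intro i _ hi
    simp only [Matrix.diag, M]
    rw [if_neg, if_neg (by omega), add_zero]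
    intro h
    apply hi
    have h2 := congrArg Fin.val h
    rw [Fin.val_rev] at h2
    ext
    simp only
    omega
  · simp

lemma Wmul_two_eq_trace (n : ℕ) : Wmul 2 n = (opMatrix n * opMatrix n).trace := by
  have hgauss : ∀ r s : ℕ, r < 2 * n + 1 →
      qbinom (2 * (n : ℤ) - r) s = gauss (2 * n - r) s := by
    intro r s hr
    rw [gauss]
    congr 1
    omega
  rw [Wmul, Matrix.trace]
  simp only [Matrix.diag, Matrix.mul_apply, opMatrix, pochPoly_coeff]
  rw [Fin.sum_univ_eq_sum_range (fun r => ∑ j : Fin (2 * n + 1),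
    qPochZ (-q) ((n : ℤ) - r) * (signTri (j : ℕ) * gauss (2 * n - r) j) *
      (qPochZ (-q) ((n : ℤ) - (j : ℕ)) * (signTri r * gauss (2 * n - j) r)))]
  rw [sum_congr rfl fun (r : ℕ) _ => Fin.sum_univ_eq_sum_range (fun j =>
    qPochZ (-q) ((n : ℤ) - r) * (signTri j * gauss (2 * n - r) j) *
      (qPochZ (-q) ((n : ℤ) - j) * (signTri r * gauss (2 * n - j) r))) (2 * n + 1), ← sum_product']
  refine sum_nbij' (fun r => (r 0, r 1)) (fun p => ![p.1, p.2]) ?_ ?_ ?_ ?_ ?_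
  · intro r hr
    simp only [Fintype.mem_piFinset] at hr
    exact mem_product.mpr ⟨hr 0, hr 1⟩
  · intro p hp
    have hp := mem_product.mp hp
    rw [Fintype.mem_piFinset]
    intro k
    fin_cases k
    · exact hp.1
    · exact hp.2
  · intro r _
    ext k
    fin_cases k <;> rfl
  · intro p _
    rfl
  · intro r hr
    simp only [Fintype.mem_piFinset, mem_range] at hr
    rw [Fin.prod_univ_two, show (0 : Fin 2) + 1 = 1 from rfl, show (1 : Fin 2) + 1 = 0 from rfl,
      hgauss _ _ (hr 0), hgauss _ _ (hr 1), ← signTri, ← signTri]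
    ring

/-- Theorem 3.1 (third part): `W_2(n) = (-1)^n q^(n(3n-1)/2)` for `n ≥ 1`. -/
theorem W2_eval (n : ℕ) (hn : 1 ≤ n) :
    Wmul 2 n = (-1 : RatFunc ℚ) ^ n * q ^ (n * (3 * n - 1) / 2) := by
  rw [Wmul_two_eq_trace, trace_opMatrix_sq, signTri, mul_assoc, ← pow_add]
  congr 2
  obtain ⟨k, rfl⟩ := Nat.exists_eq_add_of_le' hn
  rw [show (k + 1) * (3 * (k + 1) - 1) = (k + 1) * (k + 1 - 1) + (k + 1) * (k + 1) * 2 by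
    rw [show 3 * (k + 1) - 1 = 3 * k + 2 by omega, Nat.add_sub_cancel]; ring,
    Nat.add_mul_div_right _ _ two_pos]
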